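/- Let A be an essential central arrangement of d pairwise distinct hyperplanes with Orlik–Terao ideal I ⊆ R = K[y_1,…,y_d] and Orlik–Solomon ideal J ⊆ Λ(K^d). Then no square y_i² of a variable lies in I, and the K-dimension of the degree-2 component of I equals the K-dimension of the degree-2 component of J; equivalently, dim_K (I)_2 = C(d,2) − b_2, where b_2 is the K-dimension of the degree-2 component of the Orlik–Solomon algebra. -/

import Mathlib

open MvPolynomial

/-- An essential central arrangement of hyperplanes in `K^n`, with hyperplanes indexed by `ι`:
the hyperplane `H i` is the kernel of the nonzero linear form with coefficient vector `form i`,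
the forms are pairwise non-proportional (the hyperplanes are distinct), and they span the dual
space (the arrangement is essential, i.e. has rank `n`). -/
structure CentralArrangement (K : Type*) [Field K] (ι : Type*) [Fintype ι] (n : ℕ) where
  form : ι → (Fin n → K)
  nonzero : ∀ i, form i ≠ 0
  nonProportional : ∀ i j, i ≠ j → ∀ t : K, form i ≠ t • form j
  essential : Submodule.span K (Set.range form) = ⊤

namespace CentralArrangement

variable {K : Type*} [Field K] {ι : Type*} [Fintype ι] {n : ℕ}

/-- The evaluation map `K^ι → K[x_1,…,x_n]_1 ≅ K^n`, sending `e i` to the form `α i`. -/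
noncomputable def evalMap (A : CentralArrangement K ι n) : (ι → K) →ₗ[K] (Fin n → K) where
  toFun c := ∑ i, c i • A.form i
  map_add' x y := by
    simp [add_smul, Finset.sum_add_distrib]
  map_smul' t x := by
    simp [smul_smul, Finset.smul_sum]

/-- The relation space `F(A)`: the kernel of the evaluation map. -/
noncomputable def relSpace (A : CentralArrangement K ι n) : Submodule K (ι → K) :=
  LinearMap.ker A.evalMap

end CentralArrangement

open Classical in
/-- The support of a vector `c : ι → K`, as a finset. -/
noncomputable def vsupp {K ι : Type*} [Field K] [Fintype ι] (c : ι → K) : Finset ι :=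
  Finset.univ.filter fun j => c j ≠ 0

/-- The Orlik-Terao boundary `∂(c) = Σ_{j ∈ Λ} c_j · Π_{l ∈ Λ, l ≠ j} y_l`, where
`Λ` is the support of the dependency `c`. -/
noncomputable def otgen {K ι : Type*} [Field K] [Fintype ι] [DecidableEq ι] (c : ι → K) :
    MvPolynomial ι K :=
  ∑ j ∈ vsupp c, MvPolynomial.C (c j) * ∏ l ∈ (vsupp c).erase j, MvPolynomial.X l

namespace CentralArrangement

variable {K : Type*} [Field K] {ι : Type*} [Fintype ι] [DecidableEq ι] {n : ℕ}

/-- The Orlik-Terao ideal `I`, generated by `∂(c)` for all relations `c ∈ F(A)`. -/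
noncomputable def otIdeal (A : CentralArrangement K ι n) : Ideal (MvPolynomial ι K) :=
  Ideal.span (otgen '' (A.relSpace : Set (ι → K)))

/-- The quadratic component `I₂` of the Orlik-Terao ideal: the ideal generated by the
degree-2 (homogeneous) elements of `I`. -/
noncomputable def otQuadratic (A : CentralArrangement K ι n) : Ideal (MvPolynomial ι K) :=
  Ideal.span {f | f ∈ A.otIdeal ∧ f.IsHomogeneous 2}

/-- A 3-relation is an element of `F(A)` with support of size 3; the arrangement is
2-formal if the 3-relations span the relation space. -/
def IsTwoFormal (A : CentralArrangement K ι n) : Prop :=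
  Submodule.span K {c : ι → K | c ∈ A.relSpace ∧ (vsupp c).card = 3} = A.relSpace

end CentralArrangement
open ExteriorAlgebra in
/-- The Orlik-Solomon boundary element:
`∂e_{i_1…i_r} = Σ_q (−1)^{q−1} e_{i_1} ∧ ⋯ ∧ ê_{i_q} ∧ ⋯ ∧ e_{i_r}`
in the exterior algebra on `e_i = ι(Pi.single i 1)`. -/
noncomputable def osBoundary (K : Type*) [Field K] {ι : Type*} [Fintype ι] [DecidableEq ι]
    (l : List ι) : ExteriorAlgebra K (ι → K) :=
  ∑ q ∈ Finset.range l.length,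
    (-1 : K) ^ q •
      ((l.eraseIdx q).map fun i => ExteriorAlgebra.ι K (Pi.single i (1 : K))).prod

namespace CentralArrangement

variable {K : Type*} [Field K] {ι : Type*} [Fintype ι] [DecidableEq ι] {n : ℕ}

/-- The Orlik-Solomon ideal `J`: the two-sided ideal of the exterior algebra `Λ(K^ι)`
(realized as a `K`-submodule) generated by the boundaries `∂e_{i_1…i_r}` over all tuples
`(i_1,…,i_r)` whose corresponding forms `α_{i_1},…,α_{i_r}` are linearly dependent
(that is, `codim (H_{i_1} ∩ ⋯ ∩ H_{i_r}) < r`). -/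
noncomputable def osIdeal (A : CentralArrangement K ι n) :
    Submodule K (ExteriorAlgebra K (ι → K)) :=
  Submodule.span K {x | ∃ (l : List ι) (u v : ExteriorAlgebra K (ι → K)),
    (¬ LinearIndependent K fun q : Fin l.length => A.form (l.get q)) ∧
    x = u * osBoundary K l * v}

end CentralArrangement

/-- The degree-`m` graded piece of the exterior algebra `Λ(K^ι)`. -/
noncomputable def extDegree (K : Type*) [Field K] (ι : Type*) [Fintype ι] (m : ℕ) :
    Submodule K (ExteriorAlgebra K (ι → K)) :=
  (LinearMap.range (ExteriorAlgebra.ι K : (ι → K) →ₗ[K] ExteriorAlgebra K (ι → K))) ^ m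

/-- The dimension of the degree-2 component of the Orlik-Solomon algebra `Λ(K^ι)/J`,
computed as the image of the degree-2 piece of the exterior algebra in the quotient. -/
noncomputable def CentralArrangement.osBetti2 {K : Type*} [Field K] {ι : Type*} [Fintype ι]
    [DecidableEq ι] {n : ℕ} (A : CentralArrangement K ι n) : ℕ :=
  Module.finrank K ↥(Submodule.map A.osIdeal.mkQ (extDegree K ι 2))


open MvPolynomial

namespace CentralArrangement

variable {K : Type*} [Field K] {d n : ℕ}

/-- The `2 × 2` minors of the images of the forms in `K²` under the pair of functionals `p, q`. -/
def bracket (A : CentralArrangement K (Fin d) n) (p q : Module.Dual K (Fin n → K))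
    (i j : Fin d) : K :=
  p (A.form i) * q (A.form j) - p (A.form j) * q (A.form i)

lemma exists_bracket_ne_zero [CharZero K] (A : CentralArrangement K (Fin d) n) :
    ∃ p q : Module.Dual K (Fin n → K), ∀ i j, i ≠ j → A.bracket p q i j ≠ 0 := by
  obtain ⟨p, hp⟩ := Module.exists_dual_forall_apply_ne_zero (K := K) A.form A.nonzero
  obtain ⟨q, hq⟩ := Module.exists_dual_forall_apply_ne_zero (K := K)
    (fun x : {x : Fin d × Fin d // x.1 ≠ x.2} =>
      p (A.form x.1.1) • A.form x.1.2 - p (A.form x.1.2) • A.form x.1.1) (by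
    rintro ⟨⟨i, j⟩, hij⟩ h
    refine A.nonProportional i j hij ((p (A.form j))⁻¹ * p (A.form i)) ?_
    rw [mul_smul, sub_eq_zero.1 h, smul_smul, inv_mul_cancel₀ (hp j), one_smul])
  refine ⟨p, q, fun i j hij => ?_⟩
  simpa [bracket] using hq ⟨(i, j), hij⟩

lemma bracket_swap (A : CentralArrangement K (Fin d) n) (p q : Module.Dual K (Fin n → K))
    (i j : Fin d) : A.bracket p q j i = -A.bracket p q i j := by
  simp [bracket]

/-- The coefficients of a relation among three forms are proportional to the brackets. -/
lemma mul_bracket_eq (A : CentralArrangement K (Fin d) n) (p q : Module.Dual K (Fin n → K))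
    {i j k : Fin d} {a b c : K} (h : a • A.form i + b • A.form j + c • A.form k = 0) :
    a * A.bracket p q i j = c * A.bracket p q j k ∧
      b * A.bracket p q i j = c * A.bracket p q k i := by
  have hp := congrArg p h
  have hq := congrArg q h
  simp only [map_add, map_smul, smul_eq_mul, map_zero] at hp hq
  unfold bracket
  constructor
  · linear_combination q (A.form j) * hp - p (A.form j) * hq
  · linear_combination p (A.form i) * hq - q (A.form i) * hp

lemma bracket_relation (A : CentralArrangement K (Fin d) n) {p q : Module.Dual K (Fin n → K)}
    (hw : ∀ i j, i ≠ j → A.bracket p q i j ≠ 0) {i j k : Fin d} (hij : i ≠ j) {a b c : K}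
    (h : a • A.form i + b • A.form j + c • A.form k = 0) (hne : a ≠ 0 ∨ b ≠ 0 ∨ c ≠ 0) :
    A.bracket p q j k • A.form i + A.bracket p q k i • A.form j +
      A.bracket p q i j • A.form k = 0 := by
  obtain ⟨h1, h2⟩ := A.mul_bracket_eq p q h
  have hw := hw i j hij
  have hc : c ≠ 0 := by
    rintro rfl
    simp_all
  have key : c • (A.bracket p q j k • A.form i + A.bracket p q k i • A.form j +
      A.bracket p q i j • A.form k) =
      A.bracket p q i j • (a • A.form i + b • A.form j + c • A.form k) := by
    simp only [smul_add, smul_smul, ← h1, ← h2]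
    simp only [mul_comm]
  rw [h, smul_zero] at key
  exact (smul_eq_zero.1 key).resolve_left hc

lemma form_triple_dependent_iff (A : CentralArrangement K (Fin d) n) (i j k : Fin d) :
    (¬ LinearIndependent K fun x : Fin [i, j, k].length => A.form ([i, j, k].get x)) ↔
      ∃ a b c : K, a • A.form i + b • A.form j + c • A.form k = 0 ∧
        (a ≠ 0 ∨ b ≠ 0 ∨ c ≠ 0) := by
  rw [Fintype.not_linearIndependent_iff]
  change (∃ g : Fin 3 → K, ∑ x : Fin 3, g x • A.form ([i, j, k].get x) = 0 ∧
    ∃ x : Fin 3, g x ≠ 0) ↔ _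
  simp only [Fin.sum_univ_three, Fin.exists_fin_succ]
  constructor
  · rintro ⟨g, h, h'⟩
    exact ⟨g 0, g 1, g 2, h, by simpa using h'⟩
  · rintro ⟨a, b, c, h, h'⟩
    exact ⟨![a, b, c], h, by simpa using h'⟩

lemma mem_relSpace (A : CentralArrangement K (Fin d) n) (c : Fin d → K) :
    c ∈ A.relSpace ↔ ∑ i, c i • A.form i = 0 := Iff.rfl

lemma mem_vsupp {c : Fin d → K} {i : Fin d} : i ∈ vsupp c ↔ c i ≠ 0 := by
  simp [vsupp]

lemma sum_vsupp (A : CentralArrangement K (Fin d) n) {c : Fin d → K} (hc : c ∈ A.relSpace) :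
    ∑ i ∈ vsupp c, c i • A.form i = 0 := by
  rw [← (A.mem_relSpace c).1 hc]
  refine Finset.sum_subset (Finset.subset_univ _) fun i _ hi => ?_
  simp [not_not.1 (mem_vsupp.not.1 hi)]

lemma three_le_card_vsupp (A : CentralArrangement K (Fin d) n) {c : Fin d → K}
    (hc : c ∈ A.relSpace) (h0 : c ≠ 0) : 3 ≤ (vsupp c).card := by
  have hs := A.sum_vsupp hc
  by_contra! hlt
  interval_cases h : (vsupp c).card
  · refine h0 (funext fun i => ?_)
    by_contra hi
    have := mem_vsupp.2 hi
    simp_all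
  · obtain ⟨i, hi⟩ := Finset.card_eq_one.1 h
    have hci : c i ≠ 0 := mem_vsupp.1 (by simp [hi])
    simp [hi, hci, A.nonzero] at hs
  · obtain ⟨i, j, hij, hi⟩ := Finset.card_eq_two.1 h
    have hci : c i ≠ 0 := mem_vsupp.1 (by simp [hi])
    rw [hi, Finset.sum_pair hij] at hs
    refine A.nonProportional i j hij (-((c i)⁻¹ * c j)) ?_
    rw [neg_smul, mul_smul, eq_neg_of_add_eq_zero_right hs, smul_neg, neg_neg, smul_smul,
      inv_mul_cancel₀ hci, one_smul]

/-- The span of the boundaries of dependent triples. -/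
noncomputable def osTriples (A : CentralArrangement K (Fin d) n) :
    Submodule K (ExteriorAlgebra K (Fin d → K)) :=
  Submodule.span K {x | ∃ i j k : Fin d,
    (¬ LinearIndependent K fun x : Fin [i, j, k].length => A.form ([i, j, k].get x)) ∧
    x = osBoundary K [i, j, k]}

end CentralArrangement

section Exterior

variable (K : Type*) [Field K] {d : ℕ}

/-- The product `e_i ∧ e_j`. -/
noncomputable def wedge (i j : Fin d) : ExteriorAlgebra K (Fin d → K) :=
  ExteriorAlgebra.ι K (Pi.single i (1 : K)) * ExteriorAlgebra.ι K (Pi.single j (1 : K))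

lemma wedge_self (i : Fin d) : wedge K i i = 0 := ExteriorAlgebra.ι_sq_zero _

lemma wedge_swap (i j : Fin d) : wedge K j i = -wedge K i j :=
  eq_neg_of_add_eq_zero_left (ExteriorAlgebra.ι_add_mul_swap _ _)

lemma osBoundary_triple (i j k : Fin d) :
    osBoundary K [i, j, k] = wedge K j k - wedge K i k + wedge K i j := by
  simp [osBoundary, Finset.sum_range_succ, wedge, sub_eq_add_neg]

lemma osBoundary_pair_self (i : Fin d) : osBoundary K [i, i] = 0 := by
  simp [osBoundary, Finset.sum_range_succ]

lemma prod_map_ι_mem (l : List (Fin d)) :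
    (l.map fun i => ExteriorAlgebra.ι K (Pi.single i (1 : K))).prod ∈
      extDegree K (Fin d) l.length := by
  induction l with
  | nil => simp [extDegree]
  | cons i l ih =>
    rw [List.map_cons, List.prod_cons, List.length_cons, extDegree, pow_succ']
    exact Submodule.mul_mem_mul ⟨_, rfl⟩ ih

lemma osBoundary_mem (l : List (Fin d)) :
    osBoundary K l ∈ extDegree K (Fin d) (l.length - 1) := by
  refine Submodule.sum_mem _ fun q hq => Submodule.smul_mem _ _ ?_
  rw [← List.length_eraseIdx_of_lt (Finset.mem_range.1 hq)]
  exact prod_map_ι_mem K _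

/-- The coordinate functional of `e_a ∧ e_b` on the exterior algebra. -/
noncomputable def wedgeCoord (a b : Fin d) : ExteriorAlgebra K (Fin d → K) →ₗ[K] K :=
  ExteriorAlgebra.liftAlternating (R := K) (M := Fin d → K) (N := K)
    (Pi.single 2 (Matrix.detRowAlternating.compLinearMap (LinearMap.funLeft K K ![a, b])))

lemma wedgeCoord_wedge {a b i j : Fin d} (hab : a < b) (hij : i < j) :
    wedgeCoord K a b (wedge K i j) = if i = a ∧ j = b then 1 else 0 := by
  have h : wedge K i j =
      ExteriorAlgebra.ιMulti K 2 ![Pi.single i (1 : K), Pi.single j (1 : K)] := by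
    simp [ExteriorAlgebra.ιMulti_apply, wedge]
  rw [h, wedgeCoord, ExteriorAlgebra.liftAlternating_apply_ιMulti, Pi.single_eq_same,
    AlternatingMap.compLinearMap_apply]
  refine (Matrix.det_fin_two _).trans ?_
  simp only [LinearMap.funLeft_apply, Matrix.cons_val_zero, Matrix.cons_val_one, Pi.single_apply,
    Matrix.cons_val_fin_one]
  grind

lemma decompose_mul_mul_mem {S : Submodule K (ExteriorAlgebra K (Fin d → K))} {k : ℕ}
    {g : ExteriorAlgebra K (Fin d → K)} (hg : g ∈ extDegree K (Fin d) k)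
    (h : k = 2 → g ∈ S) (hk : 2 ≤ k) (u v : ExteriorAlgebra K (Fin d → K)) :
    GradedAlgebra.proj (fun i : ℕ ↦ ⋀[K]^i (Fin d → K)) 2 (u * g * v) ∈ S := by
  induction u using DirectSum.Decomposition.inductionOn (fun i : ℕ ↦ ⋀[K]^i (Fin d → K)) with
  | zero => simp
  | add u u' hu hu' => simpa [add_mul] using S.add_mem hu hu'
  | @homogeneous a u =>
    induction v using DirectSum.Decomposition.inductionOn (fun i : ℕ ↦ ⋀[K]^i (Fin d → K)) with
    | zero => simp
    | add u u' hu hu' => simpa [mul_add] using S.add_mem hu hu'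
    | @homogeneous b v =>
      have hmem : (u : ExteriorAlgebra K (Fin d → K)) * g * v ∈ ⋀[K]^(a + k + b) (Fin d → K) :=
        SetLike.mul_mem_graded (SetLike.mul_mem_graded u.2 hg) v.2
      rw [GradedAlgebra.proj_apply]
      by_cases h2 : a + k + b = 2
      · rw [h2] at hmem
        obtain ⟨rfl, rfl, rfl⟩ : a = 0 ∧ b = 0 ∧ k = 2 := by omega
        rw [DirectSum.decompose_of_mem_same (fun i : ℕ ↦ ⋀[K]^i (Fin d → K)) hmem]
        obtain ⟨u, hu⟩ := u
        obtain ⟨v, hv⟩ := v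
        obtain ⟨r, rfl⟩ := Submodule.mem_one.1 (by simpa using hu)
        obtain ⟨s, rfl⟩ := Submodule.mem_one.1 (by simpa using hv)
        simp only [Algebra.algebraMap_eq_smul_one, smul_mul_assoc, one_mul, mul_smul_comm, mul_one]
        exact S.smul_mem _ (S.smul_mem _ (h rfl))
      · rw [DirectSum.decompose_of_mem_ne (fun i : ℕ ↦ ⋀[K]^i (Fin d → K)) hmem h2]
        exact S.zero_mem

end Exterior

namespace CentralArrangement

variable {K : Type*} [Field K] {d n : ℕ}

lemma osTriples_le (A : CentralArrangement K (Fin d) n) :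
    A.osTriples ≤ A.osIdeal ⊓ extDegree K (Fin d) 2 := by
  refine Submodule.span_le.2 ?_
  rintro _ ⟨i, j, k, h, rfl⟩
  exact ⟨Submodule.subset_span ⟨[i, j, k], 1, 1, h, by simp⟩, osBoundary_mem K [i, j, k]⟩

lemma osIdeal_inf_extDegree_two (A : CentralArrangement K (Fin d) n) :
    A.osIdeal ⊓ extDegree K (Fin d) 2 = A.osTriples := by
  refine le_antisymm ?_ A.osTriples_le
  rintro x ⟨hx, hx2⟩
  suffices H : A.osIdeal ≤
      A.osTriples.comap (GradedAlgebra.proj (fun i : ℕ ↦ ⋀[K]^i (Fin d → K)) 2) by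
    have := H hx
    rwa [Submodule.mem_comap, GradedAlgebra.proj_apply,
      DirectSum.decompose_of_mem_same (fun i : ℕ ↦ ⋀[K]^i (Fin d → K)) hx2] at this
  refine Submodule.span_le.2 ?_
  rintro _ ⟨l, u, v, hl, rfl⟩
  rw [SetLike.mem_coe, Submodule.mem_comap]
  by_cases hlen : 3 ≤ l.length
  · refine decompose_mul_mul_mem K (osBoundary_mem K l) (fun h => ?_) (by omega) u v
    obtain ⟨i, j, k, rfl⟩ := List.length_eq_three.1 (show l.length = 3 by omega)
    exact Submodule.subset_span ⟨i, j, k, hl, rfl⟩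
  · suffices h : osBoundary K l = 0 by simp [h]
    match l, hl, hlen with
    | [], _, _ => simp [osBoundary]
    | [i], hl, _ =>
      refine absurd ?_ hl
      rw [Fintype.linearIndependent_iff]
      intro g hg
      change ∀ x : Fin 1, g x = 0
      change ∑ x : Fin 1, g x • A.form ([i].get x) = 0 at hg
      have : g (0 : Fin 1) = 0 := by simpa [A.nonzero i] using hg
      simpa using this
    | [i, j], hl, _ =>
      rcases eq_or_ne i j with rfl | hij
      · exact osBoundary_pair_self K i
      · refine absurd ?_ hl
        change LinearIndependent K fun q : Fin 2 => A.form ([i, j].get q)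
        rw [linearIndependent_fin2]
        exact ⟨A.nonzero j, fun t h => A.nonProportional i j hij t h.symm⟩
    | _ :: _ :: _ :: _, _, h => simp at h

lemma osBetti2_add (A : CentralArrangement K (Fin d) n) :
    A.osBetti2 + Module.finrank K ↥(A.osIdeal ⊓ extDegree K (Fin d) 2) = d.choose 2 := by
  have hfin : FiniteDimensional K (extDegree K (Fin d) 2) :=
    exteriorPower.instFinite (R := K) (M := Fin d → K) (n := 2)
  have h := (A.osIdeal.mkQ.domRestrict (extDegree K (Fin d) 2)).finrank_range_add_finrank_ker
  have h2 : Module.finrank K (extDegree K (Fin d) 2) = d.choose 2 := by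
    exact (exteriorPower.finrank_eq K 2).trans (by rw [Module.finrank_fin_fun])
  rw [h2, LinearMap.range_domRestrict, LinearMap.ker_domRestrict, Submodule.ker_mkQ] at h
  rw [osBetti2, ← h, inf_comm, ← Submodule.map_comap_subtype]
  congr 1
  exact ((Submodule.equivMapOfInjective _ (Submodule.subtype_injective _) _).finrank_eq).symm

end CentralArrangement

section Polynomial

variable {K : Type*} [Field K] {d n : ℕ}

lemma coeff_mul_of_isHomogeneous {σ R : Type*} [CommSemiring R] {a g : MvPolynomial σ R} {k : ℕ}
    (hg : g.IsHomogeneous k) {m : σ →₀ ℕ} (hm : m.degree ≤ k) :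
    coeff m (a * g) = coeff 0 a * coeff m g := by
  classical
  rw [coeff_mul]
  refine (Finset.sum_eq_single (0, m) ?_ ?_)
  · rintro ⟨x, y⟩ hxy hne
    rw [Finset.HasAntidiagonal.mem_antidiagonal] at hxy
    dsimp only at hxy ⊢
    by_cases hy : y.degree = k
    · refine absurd ?_ hne
      have hx : x.degree = 0 := by
        have := congrArg Finsupp.degree hxy
        rw [map_add] at this
        omega
      rw [Finsupp.degree_eq_zero_iff] at hx
      subst hx
      simpa using hxy
    · rw [hg.coeff_eq_zero hy, mul_zero]
  · simp

lemma otgen_isHomogeneous (c : Fin d → K) :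
    (otgen c).IsHomogeneous ((vsupp c).card - 1) := by
  refine IsHomogeneous.sum _ _ _ fun j hj => IsHomogeneous.C_mul ?_ _
  rw [← Finset.card_erase_of_mem hj, Finset.card_eq_sum_ones]
  exact IsHomogeneous.prod _ _ _ fun l _ => isHomogeneous_X K l

lemma otgen_of_vsupp_eq {c : Fin d → K} {i j k : Fin d} (hij : i ≠ j) (hik : i ≠ k) (hjk : j ≠ k)
    (h : vsupp c = {i, j, k}) :
    otgen c = c i • (X j * X k) + c j • (X i * X k) + c k • (X i * X j) := by
  have e1 : ({i, j, k} : Finset (Fin d)).erase i = {j, k} := by grind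
  have e2 : ({i, j, k} : Finset (Fin d)).erase j = {i, k} := by grind
  have e3 : ({i, j, k} : Finset (Fin d)).erase k = {i, j} := by grind
  rw [otgen, h, Finset.sum_insert (by simp [hij, hik]), Finset.sum_pair hjk, e1, e2, e3,
    Finset.prod_pair hij, Finset.prod_pair hik, Finset.prod_pair hjk]
  simp only [C_mul', add_assoc]

/-- The exponent of the monomial `y_i y_j`. -/
noncomputable def pairExp (i j : Fin d) : Fin d →₀ ℕ :=
  Finsupp.single i 1 + Finsupp.single j 1

lemma degree_pairExp (i j : Fin d) : (pairExp i j).degree = 2 := by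
  simp [pairExp]

lemma X_mul_X_eq (i j : Fin d) :
    (X i * X j : MvPolynomial (Fin d) K) = monomial (pairExp i j) 1 := by
  simp [X, pairExp, monomial_mul]

lemma pairExp_eq_iff {i j a b : Fin d} :
    pairExp i j = pairExp a b ↔ (i = a ∧ j = b) ∨ (i = b ∧ j = a) := by
  simp [pairExp, Finsupp.single_add_single_eq_single_add_single]

/-- An exponent of degree two is of the form `pairExp i j`. -/
lemma exists_eq_pairExp {m : Fin d →₀ ℕ} (hm : m.degree = 2) : ∃ i j, i ≤ j ∧ m = pairExp i j := by
  have hc : m.toMultiset.card = 2 := by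
    rw [← hm, Finsupp.card_toMultiset, Finsupp.degree_eq_sum, Finsupp.sum_fintype] <;> simp
  obtain ⟨i, j, h⟩ := Multiset.card_eq_two.1 hc
  have h' : m = pairExp i j := by
    rw [← Finsupp.toMultiset_toFinsupp m, ← Finsupp.toMultiset_toFinsupp (pairExp i j), h,
      pairExp, map_add, Finsupp.toMultiset_single, Finsupp.toMultiset_single]
    simp
  rcases le_total i j with hij | hij
  · exact ⟨i, j, hij, h'⟩
  · exact ⟨j, i, hij, by rw [h', pairExp, pairExp, add_comm]⟩

lemma coeff_pairExp_self_otgen {c : Fin d → K} (i : Fin d) :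
    coeff (pairExp i i) (otgen c) = 0 := by
  rw [otgen, coeff_sum]
  refine Finset.sum_eq_zero fun j _ => ?_
  have hm : (∏ l ∈ (vsupp c).erase j, X l : MvPolynomial (Fin d) K) =
      monomial (∑ l ∈ (vsupp c).erase j, Finsupp.single l 1) 1 := by
    rw [monomial_sum_one]
    rfl
  rw [coeff_C_mul, hm, coeff_monomial, if_neg, mul_zero]
  intro h
  have := DFunLike.congr_fun h i
  simp only [pairExp, Finsupp.finsetSum_apply, Finsupp.single_apply, Finsupp.add_apply,
    Finset.sum_ite_eq'] at this
  split_ifs at this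
  simp at this

/-- The linear map sending the square-free monomial `y_i y_j` to `w_{ij}⁻¹ e_i ∧ e_j`
and all other monomials to zero. -/
noncomputable def toExterior (w : Fin d → Fin d → K) :
    MvPolynomial (Fin d) K →ₗ[K] ExteriorAlgebra K (Fin d → K) :=
  ∑ x : Fin d × Fin d with x.1 < x.2,
    (lcoeff K (pairExp x.1 x.2)).smulRight ((w x.1 x.2)⁻¹ • wedge K x.1 x.2)

lemma toExterior_apply (w : Fin d → Fin d → K) (f : MvPolynomial (Fin d) K) :
    toExterior w f = ∑ x : Fin d × Fin d with x.1 < x.2,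
      coeff (pairExp x.1 x.2) f • (w x.1 x.2)⁻¹ • wedge K x.1 x.2 := by
  simp [toExterior, LinearMap.sum_apply]

lemma toExterior_X_mul_X {w : Fin d → Fin d → K} (hw : ∀ i j, w j i = -w i j) {i j : Fin d}
    (hij : i ≠ j) : toExterior w (X i * X j) = (w i j)⁻¹ • wedge K i j := by
  wlog h : i < j generalizing i j
  · rw [mul_comm, this hij.symm (lt_of_le_of_ne (not_lt.1 h) hij.symm), hw i j, wedge_swap,
      inv_neg, neg_smul_neg]
  rw [toExterior_apply, Finset.sum_eq_single_of_mem (i, j) (by simpa using h)]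
  · simp [X_mul_X_eq]
  · rintro ⟨a, b⟩ hab hne
    rw [X_mul_X_eq, coeff_monomial, if_neg, zero_smul]
    rw [pairExp_eq_iff]
    simp only [Finset.mem_filter] at hab
    grind

lemma wedgeCoord_toExterior (w : Fin d → Fin d → K) (f : MvPolynomial (Fin d) K) {a b : Fin d}
    (hab : a < b) :
    wedgeCoord K a b (toExterior w f) = coeff (pairExp a b) f * (w a b)⁻¹ := by
  rw [toExterior_apply, map_sum, Finset.sum_eq_single_of_mem (a, b) (by simpa using hab)]
  · simp [wedgeCoord_wedge K hab hab]
  · rintro ⟨i, j⟩ hij hne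
    simp only [Finset.mem_filter] at hij
    rw [map_smul, map_smul, wedgeCoord_wedge K hab hij.2, if_neg (by grind)]
    simp

lemma toExterior_mul {w : Fin d → Fin d → K} {a g : MvPolynomial (Fin d) K} {k : ℕ}
    (hg : g.IsHomogeneous k) (hk : 2 ≤ k) :
    toExterior w (a * g) = coeff 0 a • toExterior w g := by
  simp only [toExterior_apply, Finset.smul_sum]
  refine Finset.sum_congr rfl fun x _ => ?_
  rw [coeff_mul_of_isHomogeneous hg (by rwa [degree_pairExp]), mul_smul]

lemma toExterior_eq_zero {w : Fin d → Fin d → K} {g : MvPolynomial (Fin d) K} {k : ℕ}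
    (hg : g.IsHomogeneous k) (hk : k ≠ 2) : toExterior w g = 0 := by
  rw [toExterior_apply]
  refine Finset.sum_eq_zero fun x _ => ?_
  rw [hg.coeff_eq_zero (by rw [degree_pairExp]; exact hk.symm), zero_smul]

end Polynomial

namespace CentralArrangement

variable {K : Type*} [Field K] {d n : ℕ}

lemma otgen_zero : otgen (0 : Fin d → K) = 0 := by
  simp [otgen, vsupp]

/-- A linear map sends the Orlik-Terao ideal into `S` once it sends all multiples of the
generators into `S`. -/
lemma map_mem_of_mem_otIdeal (A : CentralArrangement K (Fin d) n) {N : Type*} [AddCommGroup N]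
    [Module K N] (L : MvPolynomial (Fin d) K →ₗ[K] N) (S : Submodule K N)
    (h : ∀ c ∈ A.relSpace, c ≠ 0 → ∀ a, L (a * otgen c) ∈ S)
    {f : MvPolynomial (Fin d) K} (hf : f ∈ A.otIdeal) : L f ∈ S := by
  suffices H : ∀ a, L (a * f) ∈ S by simpa using H 1
  induction hf using Submodule.span_induction with
  | mem x hx =>
    obtain ⟨c, hc, rfl⟩ := hx
    rcases eq_or_ne c 0 with rfl | h0
    · simp [otgen_zero]
    · exact h c hc h0
  | zero => simp
  | add x y _ _ hx hy => exact fun a => by simpa [mul_add] using S.add_mem (hx a) (hy a)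
  | smul b x _ hx => exact fun a => by simpa [mul_assoc] using hx (a * b)

lemma coeff_pairExp_self_eq_zero (A : CentralArrangement K (Fin d) n)
    {f : MvPolynomial (Fin d) K} (hf : f ∈ A.otIdeal) (i : Fin d) :
    coeff (pairExp i i) f = 0 := by
  refine (Submodule.mem_bot K).1 (A.map_mem_of_mem_otIdeal (lcoeff K (pairExp i i)) ⊥ ?_ hf)
  intro c hc h0 a
  have := A.three_le_card_vsupp hc h0
  rw [Submodule.mem_bot, lcoeff_apply, coeff_mul_of_isHomogeneous (otgen_isHomogeneous c)
    (by rw [degree_pairExp]; omega), coeff_pairExp_self_otgen, mul_zero]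

lemma toExterior_otgen_mem (A : CentralArrangement K (Fin d) n) {p q : Module.Dual K (Fin n → K)}
    (hw : ∀ i j, i ≠ j → A.bracket p q i j ≠ 0) {c : Fin d → K} (hc : c ∈ A.relSpace)
    (h3 : (vsupp c).card = 3) : toExterior (A.bracket p q) (otgen c) ∈ A.osTriples := by
  obtain ⟨i, j, k, hij, hik, hjk, h⟩ := Finset.card_eq_three.1 h3
  have hrel : c i • A.form i + c j • A.form j + c k • A.form k = 0 := by
    have := A.sum_vsupp hc
    rwa [h, Finset.sum_insert (by simp [hij, hik]), Finset.sum_pair hjk, ← add_assoc] at this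
  have hci : c i ≠ 0 := mem_vsupp.1 (by simp [h])
  obtain ⟨h1, h2⟩ := A.mul_bracket_eq p q hrel
  have e : toExterior (A.bracket p q) (otgen c) =
      (c k * (A.bracket p q i j)⁻¹) • osBoundary K [i, j, k] := by
    have hwij := hw i j hij
    have hwjk := hw j k hjk
    have hwki := hw k i hik.symm
    have e1 : c i * (A.bracket p q j k)⁻¹ = c k * (A.bracket p q i j)⁻¹ := by
      field_simp
      linear_combination h1
    have e2 : c j * (A.bracket p q i k)⁻¹ = -(c k * (A.bracket p q i j)⁻¹) := by
      rw [A.bracket_swap p q k i]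
      field_simp
      linear_combination -h2
    rw [otgen_of_vsupp_eq hij hik hjk h, osBoundary_triple]
    simp only [map_add, map_smul, toExterior_X_mul_X (A.bracket_swap p q) hij,
      toExterior_X_mul_X (A.bracket_swap p q) hik, toExterior_X_mul_X (A.bracket_swap p q) hjk,
      smul_smul, e1, e2]
    module
  rw [e]
  exact Submodule.smul_mem _ _ (Submodule.subset_span
    ⟨i, j, k, (A.form_triple_dependent_iff i j k).2 ⟨_, _, _, hrel, Or.inl hci⟩, rfl⟩)

lemma toExterior_mem_osTriples (A : CentralArrangement K (Fin d) n)
    {p q : Module.Dual K (Fin n → K)} (hw : ∀ i j, i ≠ j → A.bracket p q i j ≠ 0)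
    {f : MvPolynomial (Fin d) K} (hf : f ∈ A.otIdeal) :
    toExterior (A.bracket p q) f ∈ A.osTriples := by
  refine A.map_mem_of_mem_otIdeal _ _ (fun c hc h0 a => ?_) hf
  have h3 := A.three_le_card_vsupp hc h0
  rw [toExterior_mul (otgen_isHomogeneous c) (by omega)]
  refine Submodule.smul_mem _ _ ?_
  by_cases h : (vsupp c).card = 3
  · exact A.toExterior_otgen_mem hw hc h
  · rw [toExterior_eq_zero (otgen_isHomogeneous c) (by omega)]
    exact Submodule.zero_mem _

/-- The brackets of a dependent triple form a dependency whose Orlik-Terao boundary is sent to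
the Orlik-Solomon boundary. -/
lemma exists_otgen_of_triple (A : CentralArrangement K (Fin d) n)
    {p q : Module.Dual K (Fin n → K)} (hw : ∀ i j, i ≠ j → A.bracket p q i j ≠ 0)
    {i j k : Fin d} (hij : i ≠ j) (hik : i ≠ k) (hjk : j ≠ k)
    (h : ¬ LinearIndependent K fun x : Fin [i, j, k].length => A.form ([i, j, k].get x)) :
    ∃ c ∈ A.relSpace, (vsupp c).card = 3 ∧
      toExterior (A.bracket p q) (otgen c) = osBoundary K [i, j, k] := by
  obtain ⟨a, b, c, hrel, hne⟩ := (A.form_triple_dependent_iff i j k).1 h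
  have hbr := A.bracket_relation hw hij hrel hne
  set c : Fin d → K := Pi.single i (A.bracket p q j k) + Pi.single j (A.bracket p q k i) +
    Pi.single k (A.bracket p q i j) with hc
  have hi : c i = A.bracket p q j k := by simp [hc, hij, hik]
  have hj : c j = A.bracket p q k i := by simp [hc, hij.symm, hjk]
  have hk : c k = A.bracket p q i j := by simp [hc, hik.symm, hjk.symm]
  have hwij := hw i j hij
  have hwjk := hw j k hjk
  have hwki := hw k i hik.symm
  have hsupp : vsupp c = {i, j, k} := by
    ext l
    rw [mem_vsupp]
    by_cases h1 : l = i
    · simp [h1, hi, hwjk]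
    by_cases h2 : l = j
    · simp [h2, hj, hwki]
    by_cases h3 : l = k
    · simp [h3, hk, hwij]
    simp [hc, h1, h2, h3]
  refine ⟨c, ?_, ?_, ?_⟩
  · rw [mem_relSpace, ← hbr]
    simp [hc, add_smul, Finset.sum_add_distrib, Pi.single_apply, ite_smul]
  · rw [hsupp, Finset.card_eq_three]
    exact ⟨i, j, k, hij, hik, hjk, rfl⟩
  · rw [otgen_of_vsupp_eq hij hik hjk hsupp, osBoundary_triple, hi, hj, hk,
      A.bracket_swap p q i k]
    have hwik := hw i k hik
    simp only [map_add, map_smul, toExterior_X_mul_X (A.bracket_swap p q) hij,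
      toExterior_X_mul_X (A.bracket_swap p q) hik, toExterior_X_mul_X (A.bracket_swap p q) hjk,
      smul_smul, neg_mul, mul_inv_cancel₀ hwij, mul_inv_cancel₀ hwjk, mul_inv_cancel₀ hwik]
    module

lemma map_toExterior (A : CentralArrangement K (Fin d) n) {p q : Module.Dual K (Fin n → K)}
    (hw : ∀ i j, i ≠ j → A.bracket p q i j ≠ 0) :
    Submodule.map (toExterior (A.bracket p q))
      (Submodule.restrictScalars K A.otIdeal ⊓ homogeneousSubmodule (Fin d) K 2) =
      A.osTriples := by
  apply le_antisymm
  · rintro _ ⟨f, hf, rfl⟩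
    exact A.toExterior_mem_osTriples hw hf.1
  · refine Submodule.span_le.2 ?_
    rintro _ ⟨i, j, k, h, rfl⟩
    by_cases hd : i ≠ j ∧ i ≠ k ∧ j ≠ k
    · obtain ⟨c, hc, h3, he⟩ := A.exists_otgen_of_triple hw hd.1 hd.2.1 hd.2.2 h
      refine ⟨otgen c, ⟨Ideal.subset_span ⟨c, hc, rfl⟩, ?_⟩, he⟩
      have := otgen_isHomogeneous c
      rw [h3] at this
      exact this
    · suffices h0 : osBoundary K [i, j, k] = 0 by
        rw [h0]
        exact Submodule.zero_mem _
      rw [osBoundary_triple]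
      have : i = j ∨ i = k ∨ j = k := by tauto
      rcases this with rfl | rfl | rfl
      · simp [wedge_self]
      · simp [wedge_self, wedge_swap K i j]
      · simp [wedge_self]

lemma eq_zero_of_toExterior_eq_zero (A : CentralArrangement K (Fin d) n) {p q : Module.Dual K (Fin n → K)}
    (hw : ∀ i j, i ≠ j → A.bracket p q i j ≠ 0) {f : MvPolynomial (Fin d) K}
    (hf : f ∈ A.otIdeal) (hf2 : f.IsHomogeneous 2) (h : toExterior (A.bracket p q) f = 0) :
    f = 0 := by
  ext m
  rw [coeff_zero]
  by_cases hm : m.degree = 2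
  · obtain ⟨i, j, hij, rfl⟩ := exists_eq_pairExp hm
    rcases hij.eq_or_lt with rfl | hij
    · exact A.coeff_pairExp_self_eq_zero hf i
    · have := wedgeCoord_toExterior (A.bracket p q) f hij
      rw [h, map_zero, eq_comm, mul_eq_zero] at this
      exact this.resolve_right (inv_ne_zero (hw i j hij.ne))
  · exact hf2.coeff_eq_zero hm

lemma finrank_otIdeal_degree_two [CharZero K] (A : CentralArrangement K (Fin d) n) :
    Module.finrank K
        ↥((Submodule.restrictScalars K A.otIdeal) ⊓ homogeneousSubmodule (Fin d) K 2) =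
      Module.finrank K ↥(A.osIdeal ⊓ extDegree K (Fin d) 2) := by
  obtain ⟨p, q, hw⟩ := A.exists_bracket_ne_zero
  rw [A.osIdeal_inf_extDegree_two, ← A.map_toExterior hw, ← LinearMap.range_domRestrict]
  refine (LinearMap.finrank_range_of_inj ?_).symm
  rw [← LinearMap.ker_eq_bot, LinearMap.ker_eq_bot']
  rintro ⟨f, hf⟩ h
  exact Subtype.ext (A.eq_zero_of_toExterior_eq_zero hw hf.1 hf.2 h)

end CentralArrangement

/-- Let `A` be an essential central arrangement of `d` pairwise distinct
hyperplanes with Orlik-Terao ideal `I ⊆ R = K[y_1,…,y_d]` and Orlik-Solomon ideal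
`J ⊆ Λ(K^d)`.  Then no square `y_i²` lies in `I`, the `K`-dimension of the degree-2
component of `I` equals that of the degree-2 component of `J`, and equivalently
`dim_K (I)_2 = C(d,2) − b₂` where `b₂` is the dimension of the degree-2 component of the
Orlik-Solomon algebra. -/
theorem otIdeal_degree_two_eq_osIdeal_degree_two
    (K : Type*) [Field K] [CharZero K] (d n : ℕ)
    (A : CentralArrangement K (Fin d) n) :
    (∀ i : Fin d, (X i : MvPolynomial (Fin d) K) ^ 2 ∉ A.otIdeal) ∧
    Module.finrank K
        ↥((Submodule.restrictScalars K A.otIdeal) ⊓ homogeneousSubmodule (Fin d) K 2) =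
      Module.finrank K ↥(A.osIdeal ⊓ extDegree K (Fin d) 2) ∧
    (Module.finrank K
        ↥((Submodule.restrictScalars K A.otIdeal) ⊓ homogeneousSubmodule (Fin d) K 2) : ℤ) =
      d.choose 2 - A.osBetti2 := by
  refine ⟨fun i hi => ?_, A.finrank_otIdeal_degree_two, ?_⟩
  · have h := A.coeff_pairExp_self_eq_zero hi i
    rw [pow_two, X_mul_X_eq, coeff_monomial, if_pos rfl] at h
    exact one_ne_zero h
  · rw [A.finrank_otIdeal_degree_two, ← A.osBetti2_add]
    push_cast
    ring
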